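/- (Remark after Lemma 1) Let a > 0, k ≥ 1 and β > 0 satisfy a^k > kβ. Then for every α > 0, every λ > 0 and all ξ, x with 0 ≤ ξ ≤ x ≤ a, one has e^{−√(αλ)(a−x+ξ)}/(2β(αλ)^{k/2} + 2e^{−√(αλ)a}) ≤ (1/2)·(ka)^{k(x−ξ)/a} · β^{(ξ−x)/a} · (ln(a^k/(kβ)))^{k(ξ−x)/a}. -/

import Mathlib

theorem aux_core (k u w : ℝ) (hk : 1 ≤ k) (hu : 0 < u) (hw : 0 < w) :
    u ^ k ≤ w ^ k + k * Real.exp (k * u - w) := by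
  have hb := one_add_mul_self_le_rpow_one_add (s := w / u - 1) (by
    have : 0 < w / u := by positivity
    linarith) hk
  rw [add_sub_cancel, Real.div_rpow hw.le hu.le] at hb
  have huk : 0 < u ^ k := Real.rpow_pos_of_pos hu k
  rw [le_div_iff₀ huk] at hb
  have e1 : u ^ k = u ^ (k - 1) * u := by
    rw [← Real.rpow_add_one hu.ne']; ring_nf
  have e2 : u ^ (k - 1) ≤ Real.exp ((k - 1) * u) := by
    rw [mul_comm, Real.exp_mul]
    exact Real.rpow_le_rpow hu.le (by linarith [Real.add_one_le_exp u]) (by linarith)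
  have e3 : u - w ≤ Real.exp (u - w) := by linarith [Real.add_one_le_exp (u - w)]
  have e4 : u ^ (k - 1) * (u - w) ≤ Real.exp (k * u - w) := by
    have : Real.exp (k * u - w) = Real.exp ((k - 1) * u) * Real.exp (u - w) := by
      rw [← Real.exp_add]; ring_nf
    rw [this]
    calc u ^ (k - 1) * (u - w) ≤ u ^ (k - 1) * Real.exp (u - w) := by gcongr
      _ ≤ _ := by gcongr
  have e5 : (1 + k * (w / u - 1)) * u ^ k = u ^ k - k * (u ^ (k - 1) * (u - w)) := by
    rw [e1]; field_simp; ring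
  rw [e5] at hb
  nlinarith

theorem aux_lower (a k β z : ℝ) (ha : 0 < a) (hk : 1 ≤ k) (hβ : 0 < β)
    (h : k * β < a ^ k) (hz : 0 < z) :
    β * (Real.log (a ^ k / (k * β)) / (k * a)) ^ k ≤ β * z ^ k + Real.exp (-z * a) := by
  have hk0 : 0 < k := by linarith
  have hkb : 0 < k * β := by positivity
  have hak : 0 < a ^ k := Real.rpow_pos_of_pos ha k
  have hL : 0 < Real.log (a ^ k / (k * β)) := Real.log_pos (by rwa [one_lt_div hkb])
  have hE : Real.exp (Real.log (a ^ k / (k * β))) = a ^ k / (k * β) :=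
    Real.exp_log (by positivity)
  generalize Real.log (a ^ k / (k * β)) = L at *
  have hc := aux_core k (L / k) (z * a) hk (by positivity) (by positivity)
  have e1 : k * (L / k) - z * a = L + (-z * a) := by field_simp; ring
  rw [e1, Real.exp_add, hE, Real.mul_rpow hz.le ha.le] at hc
  rw [← div_div, Real.div_rpow (by positivity) ha.le, ← mul_div_assoc, div_le_iff₀ hak]
  calc β * (L / k) ^ k ≤ β * (z ^ k * a ^ k + k * (a ^ k / (k * β) * Real.exp (-z * a))) := by
        gcongr
    _ = _ := by field_simp

/-- Remark after Lemma 1 (inequality (2.10)): for `0 ≤ ξ ≤ x ≤ a`,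
`Ψ(β,x-ξ;α,λ) = e^{-√(αλ)(a-x+ξ)}/(2β(αλ)^{k/2} + 2e^{-√(αλ)a})
  ≤ (1/2)(ka)^{k(x-ξ)/a} β^{(ξ-x)/a} (ln(a^k/(kβ)))^{k(ξ-x)/a}`. -/
theorem stmt5 (a k β : ℝ) (ha : 0 < a) (hk : 1 ≤ k) (hβ : 0 < β)
    (h : k * β < a ^ k) :
    ∀ α : ℝ, 0 < α → ∀ lam : ℝ, 0 < lam → ∀ ξ x : ℝ, 0 ≤ ξ → ξ ≤ x → x ≤ a →
      Real.exp (-Real.sqrt (α * lam) * (a - x + ξ)) /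
          (2 * β * (α * lam) ^ (k / 2) + 2 * Real.exp (-Real.sqrt (α * lam) * a)) ≤
        (1 / 2) * (k * a) ^ (k * (x - ξ) / a) * β ^ ((ξ - x) / a) *
          (Real.log (a ^ k / (k * β))) ^ (k * (ξ - x) / a) := by
  intro α hα lam hlam ξ x hξ hξx hxa
  have hz : 0 < Real.sqrt (α * lam) := Real.sqrt_pos.2 (by positivity)
  have hzk : (α * lam) ^ (k / 2) = Real.sqrt (α * lam) ^ k := by
    rw [Real.sqrt_eq_rpow, ← Real.rpow_mul (by positivity)]; ring_nf
  rw [hzk]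
  generalize Real.sqrt (α * lam) = z at *
  have hl := aux_lower a k β z ha hk hβ h hz
  have hk0 : 0 < k := by linarith
  have hkb : 0 < k * β := by positivity
  have hL : 0 < Real.log (a ^ k / (k * β)) := Real.log_pos (by rwa [one_lt_div hkb])
  generalize Real.log (a ^ k / (k * β)) = L at *
  obtain ⟨t, ht⟩ : ∃ t, t = (x - ξ) / a := ⟨_, rfl⟩
  have ht0 : 0 ≤ t := by rw [ht]; exact div_nonneg (by linarith) ha.le
  have ht1 : t ≤ 1 := by rw [ht, div_le_one ha]; linarith
  have q1 : k * (x - ξ) / a = k * t := by rw [ht]; ring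
  have q2 : (ξ - x) / a = -t := by rw [ht]; ring
  have q3 : k * (ξ - x) / a = -(k * t) := by rw [ht]; ring
  have q4 : -z * (a - x + ξ) = (-z * a) * (1 - t) := by rw [ht]; field_simp; ring
  rw [q1, q2, q3, q4, Real.exp_mul]
  have hka : 0 < k * a := by positivity
  have hM : 0 < β * (L / (k * a)) ^ k := by positivity
  have hR : (1 / 2) * (k * a) ^ (k * t) * β ^ (-t) * L ^ (-(k * t))
      = (1 / 2) * ((β * (L / (k * a)) ^ k) ^ t)⁻¹ := by
    rw [Real.mul_rpow hβ.le (by positivity), ← Real.rpow_mul (by positivity),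
      Real.div_rpow hL.le hka.le, Real.rpow_neg hβ.le, Real.rpow_neg hL.le]
    field_simp
  rw [hR]
  have hzk0 : 0 < z ^ k := Real.rpow_pos_of_pos hz k
  have hle : Real.exp (-z * a) ≤ β * z ^ k + Real.exp (-z * a) := by
    have : 0 < β * z ^ k := by positivity
    linarith
  have hex := Real.exp_pos (-z * a)
  have hD : 2 * β * z ^ k + 2 * Real.exp (-z * a)
      = 2 * (β * z ^ k + Real.exp (-z * a)) := by ring
  rw [hD]
  generalize β * z ^ k + Real.exp (-z * a) = D at *
  have hD0 : 0 < D := by linarith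
  generalize β * (L / (k * a)) ^ k = M at *
  have f1 : Real.exp (-z * a) ^ (1 - t) ≤ D ^ (1 - t) :=
    Real.rpow_le_rpow hex.le hle (by linarith)
  have f2 : M ^ t ≤ D ^ t := Real.rpow_le_rpow hM.le hl ht0
  have hMt : 0 < M ^ t := Real.rpow_pos_of_pos hM t
  have f3 : D ^ (1 - t) * D ^ t = D := by
    rw [← Real.rpow_add hD0]; simp
  have f4 : Real.exp (-z * a) ^ (1 - t) * M ^ t ≤ D := by
    rw [← f3]
    gcongr
  rw [div_le_iff₀ (by positivity)]
  have : 1 / 2 * (M ^ t)⁻¹ * (2 * D) = D / M ^ t := by field_simp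
  rw [this, le_div_iff₀ hMt]
  exact f4
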